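/- Let 1/2 < s ≤ 3/4, b > 1/2 and b' ≤ −1/3. There exists a constant C > 0 such that for all nonnegative f₁, f₂ ∈ L²(ℝ³): ‖M(f₁,f₂)‖_{L²(ℝ³)} ≤ C ‖f₁‖_{L²} ‖f₂‖_{L²}, where M(f₁,f₂)(τ,ξ,η) := |ξ+η| ⟨(ξ,η)⟩^s ⟨τ−ξ³−η³⟩^{b'} ∫∫∫ f₁(τ₁,ξ₁,η₁) f₂(τ−τ₁, ξ−ξ₁, η−η₁) / (⟨τ₁−ξ₁³−η₁³⟩^b ⟨(ξ₁,η₁)⟩^s ⟨(τ−τ₁)−(ξ−ξ₁)³−(η−η₁)³⟩^b ⟨(ξ−ξ₁,η−η₁)⟩^s) dτ₁ dξ₁ dη₁. -/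

import Mathlib

noncomputable section

open MeasureTheory Set
open scoped ENNReal NNReal

/-- Japanese bracket `⟨a⟩ = (1+a²)^{1/2}`. -/
def jb (a : ℝ) : ℝ := Real.sqrt (1 + a ^ 2)

/-- `⟨(ξ,η)⟩ = (1+ξ²+η²)^{1/2}`. -/
def jb2 (ξ η : ℝ) : ℝ := Real.sqrt (1 + ξ ^ 2 + η ^ 2)

/-- Spatial Fourier transform on `ℝ²`. -/
def FT2 (f : ℝ × ℝ → ℂ) (p : ℝ × ℝ) : ℂ :=
  ∫ q : ℝ × ℝ, Complex.exp ((((-2) * Real.pi * (p.1 * q.1 + p.2 * q.2) : ℝ) : ℂ) * Complex.I) * f q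

/-- Inverse spatial Fourier transform on `ℝ²`. -/
def IFT2 (f : ℝ × ℝ → ℂ) (p : ℝ × ℝ) : ℂ :=
  ∫ q : ℝ × ℝ, Complex.exp (((2 * Real.pi * (p.1 * q.1 + p.2 * q.2) : ℝ) : ℂ) * Complex.I) * f q

/-- Space-time Fourier transform on `ℝ³`, variables `(t,x,y) ↦ (τ,ξ,η)`. -/
def FT3 (u : ℝ × ℝ × ℝ → ℂ) (p : ℝ × ℝ × ℝ) : ℂ :=
  ∫ q : ℝ × ℝ × ℝ, Complex.exp ((((-2) * Real.pi *
    (p.1 * q.1 + p.2.1 * q.2.1 + p.2.2 * q.2.2) : ℝ) : ℂ) * Complex.I) * u q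

/-- Bourgain norm `‖u‖_{s,b}` with weight `⟨τ-ξ³-η³⟩^b⟨(ξ,η)⟩^s`
(symmetrized Zakharov-Kuznetsov equation). -/
def XN (s b : ℝ) (u : ℝ × ℝ × ℝ → ℂ) : ℝ≥0∞ :=
  (∫⁻ p : ℝ × ℝ × ℝ,
    ENNReal.ofReal ((jb (p.1 - p.2.1 ^ 3 - p.2.2 ^ 3) ^ b * jb2 p.2.1 p.2.2 ^ s) ^ 2) *
      (‖FT3 u p‖₊ : ℝ≥0∞) ^ 2) ^ (1 / 2 : ℝ)

/-- `H^s(ℝ²)` norm. -/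
def HN (s : ℝ) (φ : ℝ × ℝ → ℂ) : ℝ≥0∞ :=
  (∫⁻ q : ℝ × ℝ, ENNReal.ofReal ((jb2 q.1 q.2 ^ s) ^ 2) * (‖FT2 φ q‖₊ : ℝ≥0∞) ^ 2) ^ (1 / 2 : ℝ)

/-- `L²(ℝ_t × ℝ²_{x,y})` norm. -/
def L2N (u : ℝ × ℝ × ℝ → ℂ) : ℝ≥0∞ :=
  (∫⁻ p : ℝ × ℝ × ℝ, (‖u p‖₊ : ℝ≥0∞) ^ 2) ^ (1 / 2 : ℝ)

/-- `L²(ℝ²)` norm. -/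
def L2N2 (φ : ℝ × ℝ → ℂ) : ℝ≥0∞ :=
  (∫⁻ q : ℝ × ℝ, (‖φ q‖₊ : ℝ≥0∞) ^ 2) ^ (1 / 2 : ℝ)

/-- Mixed norm `L^p_t L^q_{x,y}`. -/
def LpLq (p q : ℝ) (u : ℝ × ℝ × ℝ → ℂ) : ℝ≥0∞ :=
  (∫⁻ t : ℝ, (∫⁻ z : ℝ × ℝ, (‖u (t, z.1, z.2)‖₊ : ℝ≥0∞) ^ q) ^ (p / q)) ^ (1 / p)

/-- The unitary group `U(t) = e^{-t(∂_x³+∂_y³)}`, on the Fourier side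
`(U(t)φ)^(ξ,η) = e^{it(ξ³+η³)} φ̂(ξ,η)`. -/
def Ugrp (t : ℝ) (φ : ℝ × ℝ → ℂ) : ℝ × ℝ → ℂ :=
  IFT2 fun q => Complex.exp (((t * (q.1 ^ 3 + q.2 ^ 3) : ℝ) : ℂ) * Complex.I) * FT2 φ q

/-- Spatial Fourier multiplier operator (acting for each fixed time `t`). -/
def mult2 (m : ℝ × ℝ → ℂ) (u : ℝ × ℝ × ℝ → ℂ) : ℝ × ℝ × ℝ → ℂ :=
  fun p => IFT2 (fun q => m q * FT2 (fun z => u (p.1, z.1, z.2)) q) (p.2.1, p.2.2)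

/-- Bilinear operator with symbol `a(ξ₁,ξ₂,η₁,η₂)`, acting for each fixed time `t` by
`(A(f,g))^(ξ,η) = ∫_{ξ=ξ₁+ξ₂, η=η₁+η₂} a f̂(ξ₁,η₁) ĝ(ξ₂,η₂) dξ₁ dη₁`. -/
def bil (a : ℝ → ℝ → ℝ → ℝ → ℂ) (u v : ℝ × ℝ × ℝ → ℂ) : ℝ × ℝ × ℝ → ℂ :=
  fun p => IFT2 (fun ζ => ∫ w : ℝ × ℝ,
      a w.1 (ζ.1 - w.1) w.2 (ζ.2 - w.2) *
        FT2 (fun z => u (p.1, z.1, z.2)) w *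
        FT2 (fun z => v (p.1, z.1, z.2)) (ζ.1 - w.1, ζ.2 - w.2)) (p.2.1, p.2.2)

/-- Symbol of the bilinear operator `I_x^{1/2} I_{x,-}^{1/2}`:
`|ξ₁+ξ₂|^{1/2}|ξ₁-ξ₂|^{1/2}`. -/
def symIx : ℝ → ℝ → ℝ → ℝ → ℂ := fun ξ₁ ξ₂ _ _ =>
  ((|ξ₁ + ξ₂| ^ (1 / 2 : ℝ) * |ξ₁ - ξ₂| ^ (1 / 2 : ℝ) : ℝ) : ℂ)

/-- Symbol of the bilinear operator `I_y^{1/2} I_{y,-}^{1/2}`: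
`|η₁+η₂|^{1/2}|η₁-η₂|^{1/2}`. -/
def symIy : ℝ → ℝ → ℝ → ℝ → ℂ := fun _ _ η₁ η₂ =>
  ((|η₁ + η₂| ^ (1 / 2 : ℝ) * |η₁ - η₂| ^ (1 / 2 : ℝ) : ℝ) : ℂ)

/-- Sharp Fourier projection in the `y`-variable onto frequencies `η ∈ S`. -/
def PyS (S : Set ℝ) : (ℝ × ℝ × ℝ → ℂ) → ℝ × ℝ × ℝ → ℂ :=
  mult2 fun q => S.indicator (fun _ => (1 : ℂ)) q.2

/-- Dyadic projection `P_{y,k}` onto frequencies `|η| ≤ 2^k`. -/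
def Pyk (k : ℤ) : (ℝ × ℝ × ℝ → ℂ) → ℝ × ℝ × ℝ → ℂ :=
  PyS {η : ℝ | |η| ≤ (2 : ℝ) ^ k}

/-- Bessel potential `J_y^s` in the `y`-variable, symbol `⟨η⟩^s`. -/
def Jy (s : ℝ) : (ℝ × ℝ × ℝ → ℂ) → ℝ × ℝ × ℝ → ℂ :=
  mult2 fun q => ((jb q.2 ^ s : ℝ) : ℂ)

/-- Bessel potential `J_x^s` in the `x`-variable, symbol `⟨ξ⟩^s`. -/
def Jx (s : ℝ) : (ℝ × ℝ × ℝ → ℂ) → ℝ × ℝ × ℝ → ℂ :=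
  mult2 fun q => ((jb q.1 ^ s : ℝ) : ℂ)

/-- The operator `∂_x + ∂_y`, with spatial Fourier symbol `i(ξ+η)`. -/
def DxDy : (ℝ × ℝ × ℝ → ℂ) → ℝ × ℝ × ℝ → ℂ :=
  mult2 fun q => Complex.I * ((q.1 + q.2 : ℝ) : ℂ)

/-- A fixed smooth, even cut-off `ψ ∈ C₀^∞(-2,2)`, `0 ≤ ψ ≤ 1`, `ψ = 1` on `[-1,1]`. -/
def IsCutoff (ψ : ℝ → ℝ) : Prop :=
  ContDiff ℝ (⊤ : ℕ∞) ψ ∧ HasCompactSupport ψ ∧ tsupport ψ ⊆ Set.Ioo (-2) 2 ∧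
    (∀ t, ψ (-t) = ψ t) ∧ (∀ t, ψ t ∈ Set.Icc (0 : ℝ) 1) ∧ (∀ t, |t| ≤ 1 → ψ t = 1)


/-- `L²(ℝ³)` norm for real-valued functions. -/
def L2NR (f : ℝ × ℝ × ℝ → ℝ) : ℝ≥0∞ :=
  (∫⁻ p : ℝ × ℝ × ℝ, (‖f p‖₊ : ℝ≥0∞) ^ 2) ^ (1 / 2 : ℝ)

/-- The weighted convolution operator `M(f₁,f₂)` of the key estimate. -/
def Mop (s b b' : ℝ) (f₁ f₂ : ℝ × ℝ × ℝ → ℝ) (p : ℝ × ℝ × ℝ) : ℝ≥0∞ :=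
  ENNReal.ofReal
      (|p.2.1 + p.2.2| * jb2 p.2.1 p.2.2 ^ s * jb (p.1 - p.2.1 ^ 3 - p.2.2 ^ 3) ^ b') *
    ∫⁻ w : ℝ × ℝ × ℝ,
      ENNReal.ofReal (f₁ w) *
          ENNReal.ofReal (f₂ (p.1 - w.1, p.2.1 - w.2.1, p.2.2 - w.2.2)) /
        ENNReal.ofReal
          (jb (w.1 - w.2.1 ^ 3 - w.2.2 ^ 3) ^ b * jb2 w.2.1 w.2.2 ^ s *
            jb ((p.1 - w.1) - (p.2.1 - w.2.1) ^ 3 - (p.2.2 - w.2.2) ^ 3) ^ b *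
            jb2 (p.2.1 - w.2.1) (p.2.2 - w.2.2) ^ s)

/-- `L²` norm for `ℝ≥0∞`-valued functions. -/
def nrm2 {α : Type*} [MeasurableSpace α] (μ : Measure α) (f : α → ℝ≥0∞) : ℝ≥0∞ :=
  (∫⁻ x, f x ^ 2 ∂μ) ^ (1 / 2 : ℝ)

lemma half_sq (a : ℝ≥0∞) : (a ^ (1 / 2 : ℝ)) ^ 2 = a := by
  rw [← ENNReal.rpow_natCast, ← ENNReal.rpow_mul]; norm_num

lemma sq_half (a : ℝ≥0∞) : (a ^ 2) ^ (1 / 2 : ℝ) = a := by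
  rw [← ENNReal.rpow_natCast, ← ENNReal.rpow_mul]; norm_num

lemma nrm2_sq {α : Type*} [MeasurableSpace α] (μ : Measure α) (f : α → ℝ≥0∞) :
    nrm2 μ f ^ 2 = ∫⁻ x, f x ^ 2 ∂μ := half_sq _

lemma cs {α : Type*} [MeasurableSpace α] (μ : Measure α) (f g : α → ℝ≥0∞)
    (hf : Measurable f) (hg : Measurable g) :
    ∫⁻ x, f x * g x ∂μ ≤ nrm2 μ f * nrm2 μ g := by
  have := ENNReal.lintegral_mul_le_Lp_mul_Lq μ (p := 2) (q := 2)
    (by constructor <;> norm_num) hf.aemeasurable hg.aemeasurable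
  simpa [nrm2] using this

/-- Duality. -/
lemma dual {α : Type*} [MeasurableSpace α] (μ : Measure α) [SigmaFinite μ] (M : α → ℝ≥0∞)
    (C : ℝ≥0∞)
    (h : ∀ g : α → ℝ≥0∞, Measurable g → ∫⁻ x, M x * g x ∂μ ≤ C * nrm2 μ g) :
    nrm2 μ M ≤ C := by
  suffices hh : ∫⁻ x, M x ^ 2 ∂μ ≤ C ^ 2 by
    have := ENNReal.rpow_le_rpow hh (z := 1 / 2) (by norm_num)
    rwa [sq_half] at this
  by_contra hcon
  push Not at hcon
  rw [lintegral_eq_nnreal] at hcon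
  simp only [lt_iSup_iff] at hcon
  obtain ⟨ψ, hψ, hlt⟩ := hcon
  rw [← SimpleFunc.lintegral_eq_lintegral] at hlt
  obtain ⟨φ, hφ1, hφ2, hφ3⟩ := SimpleFunc.exists_lt_lintegral_simpleFunc_of_lt_lintegral
    (μ := μ) (f := ψ) (L := C ^ 2) (by simpa using hlt)
  have hm : Measurable (fun x => (φ x : ℝ≥0∞) ^ (1 / 2 : ℝ)) := by
    have := φ.measurable
    fun_prop
  have h1 := h _ hm
  have h2 : nrm2 μ (fun x => (φ x : ℝ≥0∞) ^ (1 / 2 : ℝ)) = (∫⁻ x, φ x ∂μ) ^ (1 / 2 : ℝ) := by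
    simp only [nrm2, half_sq]
  have h3 : ∫⁻ x, φ x ∂μ ≤ ∫⁻ x, M x * (φ x : ℝ≥0∞) ^ (1 / 2 : ℝ) ∂μ := by
    refine lintegral_mono fun x => ?_
    have h4 : (φ x : ℝ≥0∞) ≤ M x ^ 2 :=
      le_trans (by exact_mod_cast hφ1 x) (hψ x)
    have h5 := ENNReal.rpow_le_rpow h4 (z := 1 / 2) (by norm_num)
    rw [sq_half] at h5
    calc (φ x : ℝ≥0∞) = ((φ x : ℝ≥0∞) ^ (1 / 2 : ℝ)) ^ 2 := (half_sq _).symm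
      _ = (φ x : ℝ≥0∞) ^ (1 / 2 : ℝ) * (φ x : ℝ≥0∞) ^ (1 / 2 : ℝ) := sq _
      _ ≤ _ := by gcongr
  rw [h2] at h1
  set I := ∫⁻ x, φ x ∂μ with hI
  set J := I ^ (1 / 2 : ℝ) with hJ
  have hJ2 : J ^ 2 = I := half_sq _
  have hJt : J ≠ ⊤ := by
    intro hh; rw [hh] at hJ2; simp at hJ2; exact hφ2.ne hJ2.symm
  have hJ0 : J ≠ 0 := by
    intro hh; rw [hh] at hJ2; simp at hJ2; rw [← hJ2] at hφ3; simp at hφ3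
  have h6 : J * J ≤ C * J := by
    rw [← sq, hJ2]; exact h3.trans h1
  have h7 : J ≤ C := (ENNReal.mul_le_mul_iff_left hJ0 hJt).1 h6
  have h8 : I ≤ C ^ 2 := by rw [← hJ2]; gcongr
  exact absurd hφ3 (not_lt.2 h8)

lemma cs2 {α β : Type*} [MeasurableSpace α] [MeasurableSpace β] (μ : Measure α) (ν : Measure β)
    [SFinite μ] [SFinite ν]
    (H G : α → β → ℝ≥0∞) (F : α → ℝ≥0∞) (hH : Measurable (Function.uncurry H))
    (hG : Measurable (Function.uncurry G)) (hF : Measurable F) (A : ℝ≥0∞)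
    (hA : ∀ x, ∫⁻ y, H x y ^ 2 ∂ν ≤ A) :
    ∫⁻ x, ∫⁻ y, H x y * (F x * G x y) ∂ν ∂μ ≤
      A ^ (1 / 2 : ℝ) * nrm2 μ F * (∫⁻ x, ∫⁻ y, G x y ^ 2 ∂ν ∂μ) ^ (1 / 2 : ℝ) := by
  have hHx : ∀ x, Measurable (H x) := fun x => hH.comp measurable_prodMk_left
  have hGx : ∀ x, Measurable (G x) := fun x => hG.comp measurable_prodMk_left
  have hn : Measurable (fun x => nrm2 ν (G x)) := by
    unfold nrm2
    exact (Measurable.lintegral_prod_right' (hG.pow_const 2)).pow_const _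
  calc ∫⁻ x, ∫⁻ y, H x y * (F x * G x y) ∂ν ∂μ
      ≤ ∫⁻ x, A ^ (1 / 2 : ℝ) * (F x * nrm2 ν (G x)) ∂μ := by
        refine lintegral_mono fun x => ?_
        calc ∫⁻ y, H x y * (F x * G x y) ∂ν = ∫⁻ y, F x * (H x y * G x y) ∂ν := by
              congr 1; ext y; ring
          _ = F x * ∫⁻ y, H x y * G x y ∂ν := lintegral_const_mul _ ((hHx x).mul (hGx x))
          _ ≤ F x * (nrm2 ν (H x) * nrm2 ν (G x)) := by
              gcongr; exact cs ν _ _ (hHx x) (hGx x)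
          _ ≤ F x * (A ^ (1 / 2 : ℝ) * nrm2 ν (G x)) := by
              gcongr
              exact ENNReal.rpow_le_rpow (hA x) (by norm_num)
          _ = _ := by ring
    _ = A ^ (1 / 2 : ℝ) * ∫⁻ x, F x * nrm2 ν (G x) ∂μ := lintegral_const_mul _ (hF.mul hn)
    _ ≤ A ^ (1 / 2 : ℝ) * (nrm2 μ F * nrm2 μ (fun x => nrm2 ν (G x))) := by
        gcongr; exact cs μ _ _ hF hn
    _ = _ := by
        rw [mul_assoc]; congr 2
        unfold nrm2
        simp only [half_sq]

/-- The frequency space. -/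
abbrev E3 : Type := ℝ × ℝ × ℝ

instance E3_inv : (volume : Measure E3).IsAddRightInvariant := by
  have h2 : ((volume : Measure ℝ).prod (volume : Measure ℝ)).IsAddHaarMeasure := inferInstance
  have h3 : ((volume : Measure ℝ).prod
    ((volume : Measure ℝ).prod (volume : Measure ℝ))).IsAddHaarMeasure := inferInstance
  have : (volume : Measure E3).IsAddHaarMeasure := h3
  infer_instance

def n2 (f : E3 → ℝ≥0∞) : ℝ≥0∞ := nrm2 (volume : Measure E3) f

/-- Kernels giving bounded trilinear forms on `L²`. -/
def Good (k : E3 → E3 → ℝ≥0∞) : Prop :=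
  ∃ C : ℝ≥0, ∀ f₁ f₂ g : E3 → ℝ≥0∞, Measurable f₁ → Measurable f₂ → Measurable g →
    ∫⁻ w : E3, ∫⁻ v : E3, k w v * (f₁ w * f₂ v * g (w + v)) ≤ C * n2 f₁ * n2 f₂ * n2 g

lemma Good.mono {k k' : E3 → E3 → ℝ≥0∞} (h : Good k) (C : ℝ≥0) (hk : ∀ w v, k' w v ≤ C * k w v) :
    Good k' := by
  obtain ⟨D, hD⟩ := h
  refine ⟨C * D, fun f₁ f₂ g h1 h2 h3 => ?_⟩
  calc _ ≤ ∫⁻ w : E3, ∫⁻ v : E3, C * (k w v * (f₁ w * f₂ v * g (w + v))) := by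
        refine lintegral_mono fun w => lintegral_mono fun v => ?_
        rw [← mul_assoc (C : ℝ≥0∞)]
        exact mul_le_mul_left (hk w v) _
    _ = C * ∫⁻ w : E3, ∫⁻ v : E3, (k w v * (f₁ w * f₂ v * g (w + v))) := by
        simp_rw [lintegral_const_mul' _ _ (ENNReal.coe_ne_top (r := C))]
    _ ≤ C * (D * n2 f₁ * n2 f₂ * n2 g) := by gcongr; exact hD _ _ _ h1 h2 h3
    _ = _ := by push_cast; ring

lemma Good.add {k k' : E3 → E3 → ℝ≥0∞} (h : Good k) (h' : Good k')
    (hm : Measurable (Function.uncurry k)) :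
    Good (fun w v => k w v + k' w v) := by
  obtain ⟨D, hD⟩ := h
  obtain ⟨D', hD'⟩ := h'
  refine ⟨D + D', fun f₁ f₂ g h1 h2 h3 => ?_⟩
  have hu : Measurable (fun p : E3 × E3 => k p.1 p.2 * (f₁ p.1 * f₂ p.2 * g (p.1 + p.2))) := by
    have : Measurable (fun p : E3 × E3 => k p.1 p.2) := hm
    fun_prop
  calc _ = (∫⁻ w : E3, ∫⁻ v : E3, (k w v * (f₁ w * f₂ v * g (w + v)))) +
        ∫⁻ w : E3, ∫⁻ v : E3, (k' w v * (f₁ w * f₂ v * g (w + v))) := by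
        rw [← lintegral_add_left (Measurable.lintegral_prod_right' hu)]
        congr 1; ext w
        have hw : Measurable (fun v : E3 => k w v * (f₁ w * f₂ v * g (w + v))) :=
          hu.comp (measurable_prodMk_left (x := w))
        rw [← lintegral_add_left hw]
        congr 1; ext v
        simp only [add_mul]
    _ ≤ D * n2 f₁ * n2 f₂ * n2 g + D' * n2 f₁ * n2 f₂ * n2 g :=
        add_le_add (hD _ _ _ h1 h2 h3) (hD' _ _ _ h1 h2 h3)
    _ = _ := by push_cast; ring

lemma Good.swap {k : E3 → E3 → ℝ≥0∞} (h : Good k) (hm : Measurable (Function.uncurry k)) :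
    Good (fun w v => k v w) := by
  obtain ⟨D, hD⟩ := h
  refine ⟨D, fun f₁ f₂ g h1 h2 h3 => ?_⟩
  have hk : Measurable (fun p : E3 × E3 => k p.1 p.2) := hm
  have hu : Measurable (fun p : E3 × E3 => k p.2 p.1 * (f₁ p.1 * f₂ p.2 * g (p.1 + p.2))) := by
    have : Measurable (fun p : E3 × E3 => k p.2 p.1) := hk.comp measurable_swap
    fun_prop
  rw [lintegral_lintegral_swap hu.aemeasurable]
  calc _ = ∫⁻ w : E3, ∫⁻ v : E3, (k w v * (f₂ w * f₁ v * g (w + v))) := by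
        congr 1; ext w; congr 1; ext v
        rw [mul_comm (f₁ v), add_comm v w]
    _ ≤ _ := hD _ _ _ h2 h1 h3
    _ = _ := by ring

/-- Swap of the two space frequencies. -/
def S3 (w : E3) : E3 := (w.1, w.2.2, w.2.1)

lemma S3_mp : MeasurePreserving S3 (volume : Measure E3) volume := by
  have : MeasurePreserving (Prod.map id Prod.swap : E3 → E3) (volume : Measure E3) volume :=
    (MeasurePreserving.id (volume : Measure ℝ)).prod
      (Measure.measurePreserving_swap (μ := (volume : Measure ℝ)) (ν := (volume : Measure ℝ)))
  exact this

lemma S3_meas : Measurable S3 := S3_mp.measurable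

lemma S3_S3 (w : E3) : S3 (S3 w) = w := rfl

lemma lint_S3 (f : E3 → ℝ≥0∞) : ∫⁻ w, f (S3 w) = ∫⁻ w, f w := by
  let e : E3 ≃ᵐ E3 := ⟨⟨S3, S3, fun _ => rfl, fun _ => rfl⟩, S3_meas, S3_meas⟩
  exact S3_mp.lintegral_comp_emb e.measurableEmbedding f

lemma n2_S3 (f : E3 → ℝ≥0∞) : n2 (fun w => f (S3 w)) = n2 f := by
  unfold n2 nrm2
  rw [lint_S3 (fun w => f w ^ 2)]

lemma Good.refl {k : E3 → E3 → ℝ≥0∞} (h : Good k) : Good (fun w v => k (S3 w) (S3 v)) := by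
  obtain ⟨D, hD⟩ := h
  refine ⟨D, fun f₁ f₂ g h1 h2 h3 => ?_⟩
  have h4 := hD (fun w => f₁ (S3 w)) (fun w => f₂ (S3 w)) (fun w => g (S3 w))
    (h1.comp S3_meas) (h2.comp S3_meas) (h3.comp S3_meas)
  rw [n2_S3, n2_S3, n2_S3] at h4
  rw [← lint_S3]
  refine le_trans (le_of_eq ?_) h4
  congr 1; ext w
  rw [← lint_S3]
  rfl

/-- Fixed first variable... -/
lemma good_of_left {k : E3 → E3 → ℝ≥0∞} (hm : Measurable (Function.uncurry k)) (A : ℝ≥0)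
    (hA : ∀ v, ∫⁻ w, k w v ^ 2 ≤ A) : Good k := by
  refine ⟨A ^ (1 / 2 : ℝ), fun f₁ f₂ g h1 h2 h3 => ?_⟩
  have hk : Measurable (fun p : E3 × E3 => k p.1 p.2) := hm
  have hk' : Measurable (fun p : E3 × E3 => k p.2 p.1) := hk.comp measurable_swap
  have hu : Measurable (fun p : E3 × E3 => k p.1 p.2 * (f₁ p.1 * f₂ p.2 * g (p.1 + p.2))) := by
    fun_prop
  have hG : Measurable (fun p : E3 × E3 => f₁ p.2 * g (p.1 + p.2)) := by fun_prop
  rw [lintegral_lintegral_swap hu.aemeasurable]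
  have := cs2 volume volume (fun v w => k w v) (fun v w => f₁ w * g (v + w)) f₂ hk' hG h2 A hA
  calc _ = ∫⁻ v : E3, ∫⁻ w : E3, (k w v * (f₂ v * (f₁ w * g (v + w)))) := by
        congr 1; ext v; congr 1; ext w
        rw [add_comm w v]; ring
    _ ≤ _ := this
    _ = (A ^ (1 / 2 : ℝ) : ℝ≥0) * n2 f₂ * (n2 f₁ * n2 g) := by
        rw [ENNReal.coe_rpow_of_nonneg _ (by norm_num)]
        congr 1
        rw [lintegral_lintegral_swap (by exact (hG.pow_const 2).aemeasurable)]
        simp_rw [mul_pow]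
        have h5 : ∀ w : E3, ∫⁻ v, f₁ w ^ 2 * g (v + w) ^ 2 = f₁ w ^ 2 * n2 g ^ 2 := by
          intro w
          rw [lintegral_const_mul _ (by fun_prop),
            lintegral_add_right_eq_self (fun v => g v ^ 2) w, n2, nrm2_sq]
        simp_rw [h5]
        rw [lintegral_mul_const _ (by fun_prop), ← nrm2_sq, ← mul_pow, sq_half, n2, n2]
    _ = _ := by ring

lemma good_of_sum {k : E3 → E3 → ℝ≥0∞} (hm : Measurable (Function.uncurry k)) (A : ℝ≥0)
    (hA : ∀ p, ∫⁻ w, k w (p - w) ^ 2 ≤ A) : Good k := by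
  refine ⟨A ^ (1 / 2 : ℝ), fun f₁ f₂ g h1 h2 h3 => ?_⟩
  have hk : Measurable (fun p : E3 × E3 => k p.1 p.2) := hm
  have hk' : Measurable (fun p : E3 × E3 => k p.2 (p.1 - p.2)) :=
    hk.comp (by fun_prop : Measurable (fun p : E3 × E3 => (p.2, p.1 - p.2)))
  have hk'' : Measurable (fun p : E3 × E3 => k p.1 (p.2 - p.1)) :=
    hk.comp (by fun_prop : Measurable (fun p : E3 × E3 => (p.1, p.2 - p.1)))
  have hu : Measurable (fun p : E3 × E3 => k p.1 (p.2 - p.1) * (f₁ p.1 * f₂ (p.2 - p.1) * g p.2)) := by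
    fun_prop
  have hG : Measurable (fun p : E3 × E3 => f₁ p.2 * f₂ (p.1 - p.2)) := by fun_prop
  have := cs2 volume volume (fun p w => k w (p - w)) (fun p w => f₁ w * f₂ (p - w)) g hk' hG h3 A hA
  calc _ = ∫⁻ w : E3, ∫⁻ p : E3, k w (p - w) * (f₁ w * f₂ (p - w) * g p) := by
        congr 1; ext w
        rw [← lintegral_sub_right_eq_self _ w]
        simp
    _ = ∫⁻ p : E3, ∫⁻ w : E3, k w (p - w) * (f₁ w * f₂ (p - w) * g p) :=
        lintegral_lintegral_swap hu.aemeasurable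
    _ = ∫⁻ p : E3, ∫⁻ w : E3, (k w (p - w) * (g p * (f₁ w * f₂ (p - w)))) := by
        congr 1; ext v; congr 1; ext w
        ring
    _ ≤ _ := this
    _ = (A ^ (1 / 2 : ℝ) : ℝ≥0) * n2 g * (n2 f₁ * n2 f₂) := by
        rw [ENNReal.coe_rpow_of_nonneg _ (by norm_num)]
        congr 1
        rw [lintegral_lintegral_swap (by exact (hG.pow_const 2).aemeasurable)]
        simp_rw [mul_pow]
        have h5 : ∀ w : E3, ∫⁻ v, f₁ w ^ 2 * f₂ (v - w) ^ 2 = f₁ w ^ 2 * n2 f₂ ^ 2 := by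
          intro w
          rw [lintegral_const_mul _ (by fun_prop),
            lintegral_sub_right_eq_self (fun v => f₂ v ^ 2) w, n2, nrm2_sq]
        simp_rw [h5]
        rw [lintegral_mul_const _ (by fun_prop), ← nrm2_sq, ← mul_pow, sq_half, n2, n2]
    _ = _ := by ring


lemma jb_one_le (a : ℝ) : 1 ≤ jb a := by
  unfold jb; exact Real.one_le_sqrt.2 (by nlinarith [sq_nonneg a])

lemma jb_pos (a : ℝ) : 0 < jb a := lt_of_lt_of_le one_pos (jb_one_le a)

lemma jb2_one_le (a c : ℝ) : 1 ≤ jb2 a c := by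
  unfold jb2; exact Real.one_le_sqrt.2 (by nlinarith [sq_nonneg a, sq_nonneg c])

lemma jb2_pos (a c : ℝ) : 0 < jb2 a c := lt_of_lt_of_le one_pos (jb2_one_le a c)

lemma jb_neg (a : ℝ) : jb (-a) = jb a := by simp [jb]

@[fun_prop]
lemma jb_meas : Measurable jb := by unfold jb; fun_prop

/-- The squared bracket weight. -/
def Fw (b : ℝ) (x : ℝ) : ℝ≥0∞ := ENNReal.ofReal (jb x ^ (-(2 * b)))

@[fun_prop]
lemma Fw_meas (b : ℝ) : Measurable (Fw b) := by unfold Fw; fun_prop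

lemma Fw_le_one {b : ℝ} (hb : 1 / 2 < b) (x : ℝ) : Fw b x ≤ 1 := by
  unfold Fw
  rw [ENNReal.ofReal_le_one]
  exact Real.rpow_le_one_of_one_le_of_nonpos (jb_one_le x) (by linarith)

lemma Fw_int {b : ℝ} (hb : 1 / 2 < b) : ∃ J : ℝ≥0, ∫⁻ x, Fw b x ≤ J := by
  have h := integrable_rpow_neg_one_add_norm_sq (E := ℝ) (μ := volume) (r := 2 * b)
    (by simp; linarith)
  have h2 : Integrable (fun x : ℝ => jb x ^ (-(2 * b))) := by
    refine h.congr (Filter.Eventually.of_forall fun x => ?_)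
    simp only [jb, Real.norm_eq_abs, sq_abs]
    rw [Real.sqrt_eq_rpow, ← Real.rpow_mul (by positivity)]
    congr 1; ring
  have h3 := h2.lintegral_lt_top
  exact ⟨(∫⁻ x, Fw b x).toNNReal, (ENNReal.coe_toNNReal h3.ne).ge⟩

lemma Fw_neg (b x : ℝ) : Fw b (-x) = Fw b x := by simp [Fw, jb_neg]

/-- Change of variables for a quadratic phase. -/
lemma quad_int (F : ℝ → ℝ≥0∞) (hF : Measurable F) (α β γ : ℝ) :
    ∫⁻ x, ENNReal.ofReal |2 * α * x + β| * F (α * x ^ 2 + β * x + γ) ≤ 2 * ∫⁻ x, F x := by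
  have key : ∀ s : Set ℝ, MeasurableSet s → InjOn (fun x => α * x ^ 2 + β * x + γ) s →
      ∫⁻ x in s, ENNReal.ofReal |2 * α * x + β| * F (α * x ^ 2 + β * x + γ) ≤ ∫⁻ x, F x := by
    intro s hs hi
    have := lintegral_image_eq_lintegral_abs_deriv_mul hs
      (f := fun x => α * x ^ 2 + β * x + γ) (f' := fun x => 2 * α * x + β)
      (fun x _ => by
        have h1 : HasDerivAt (fun x : ℝ => α * x ^ 2 + β * x + γ) (α * (2 * x) + β * 1) x := by
          have := (((hasDerivAt_pow 2 x).const_mul α).add ((hasDerivAt_id x).const_mul β)).add_const γ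
          simpa using this
        exact (h1.congr_deriv (by ring)).hasDerivWithinAt) hi F
    rw [← this]
    exact setLIntegral_le_lintegral _ _
  have hinj : ∀ x y : ℝ, α * x ^ 2 + β * x + γ = α * y ^ 2 + β * y + γ →
      (x - y) * ((2 * α * x + β) + (2 * α * y + β)) = 0 := by
    intro x y h; linear_combination 2 * h
  have e1 : MeasurableSet {x : ℝ | 0 < 2 * α * x + β} :=
    measurableSet_lt measurable_const (by fun_prop)
  have e2 : MeasurableSet {x : ℝ | 2 * α * x + β < 0} :=
    measurableSet_lt (by fun_prop) measurable_const
  have k1 := key _ e1 (by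
    intro x hx y hy h
    simp only [mem_ofPred_eq] at hx hy
    rcases mul_eq_zero.1 (hinj x y h) with h | h
    · linarith
    · linarith)
  have k2 := key _ e2 (by
    intro x hx y hy h
    simp only [mem_ofPred_eq] at hx hy
    rcases mul_eq_zero.1 (hinj x y h) with h | h
    · linarith
    · linarith)
  rw [two_mul (∫⁻ x, F x)]
  refine le_trans ?_ (add_le_add k1 k2)
  rw [← lintegral_indicator e1, ← lintegral_indicator e2]
  rw [← lintegral_add_left (Measurable.indicator (by fun_prop) e1)]
  refine lintegral_mono fun x => ?_
  simp only [indicator, mem_ofPred_eq]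
  rcases lt_trichotomy (2 * α * x + β) 0 with h | h | h
  · simp [h]
  · simp [h]
  · simp [h]

lemma triple_int (b : ℝ) (D h : ℝ → ℝ≥0∞) (A B : ℝ → ℝ → ℝ) (C J K : ℝ≥0∞)
    (hD : Measurable D) (hh : Measurable h) (hA : Measurable (fun p : ℝ × ℝ => A p.1 p.2))
    (hB : Measurable (fun p : ℝ × ℝ => B p.1 p.2))
    (hJ : ∫⁻ x, Fw b x ≤ J) (hK : ∫⁻ y, h y ≤ K)
    (H : ∀ y l, ∫⁻ x, D x * Fw b (l + A x y - B x y) ≤ C) :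
    ∫⁻ w : E3, D w.2.1 * h w.2.2 * (Fw b (w.1 - A w.2.1 w.2.2) * Fw b (w.1 - B w.2.1 w.2.2))
      ≤ C * J * K := by
  have hA' : Measurable (fun p : E3 => A p.2.1 p.2.2) := hA.comp measurable_snd
  have hB' : Measurable (fun p : E3 => B p.2.1 p.2.2) := hB.comp measurable_snd
  have m1 : Measurable (fun w : E3 => D w.2.1 * h w.2.2 *
      (Fw b (w.1 - A w.2.1 w.2.2) * Fw b (w.1 - B w.2.1 w.2.2))) := by fun_prop
  have m2 : Measurable (fun w : E3 => D w.2.1 * h w.2.2 *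
      (Fw b w.1 * Fw b (w.1 + A w.2.1 w.2.2 - B w.2.1 w.2.2))) := by fun_prop
  calc ∫⁻ w : E3, D w.2.1 * h w.2.2 * (Fw b (w.1 - A w.2.1 w.2.2) * Fw b (w.1 - B w.2.1 w.2.2))
      = ∫⁻ z : ℝ × ℝ, ∫⁻ t : ℝ, D z.1 * h z.2 * (Fw b (t - A z.1 z.2) * Fw b (t - B z.1 z.2)) := by
        rw [Measure.volume_eq_prod, lintegral_prod_symm _ m1.aemeasurable]
    _ = ∫⁻ z : ℝ × ℝ, ∫⁻ t : ℝ, D z.1 * h z.2 * (Fw b t * Fw b (t + A z.1 z.2 - B z.1 z.2)) := by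
        congr 1; ext z
        rw [← lintegral_add_right_eq_self _ (A z.1 z.2)]
        simp
    _ = ∫⁻ t : ℝ, ∫⁻ z : ℝ × ℝ, D z.1 * h z.2 * (Fw b t * Fw b (t + A z.1 z.2 - B z.1 z.2)) := by
        rw [lintegral_lintegral_swap]
        exact (m2.comp measurable_swap).aemeasurable
    _ = ∫⁻ t : ℝ, ∫⁻ y : ℝ, ∫⁻ x : ℝ, D x * h y * (Fw b t * Fw b (t + A x y - B x y)) := by
        congr 1; ext t
        rw [Measure.volume_eq_prod, lintegral_prod_symm]
        exact (m2.comp measurable_prodMk_left).aemeasurable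
    _ ≤ ∫⁻ t : ℝ, ∫⁻ y : ℝ, (Fw b t * C) * h y := by
        refine lintegral_mono fun t => lintegral_mono fun y => ?_
        calc ∫⁻ x : ℝ, D x * h y * (Fw b t * Fw b (t + A x y - B x y))
            = ∫⁻ x : ℝ, (Fw b t * h y) * (D x * Fw b (t + A x y - B x y)) := by
              congr 1; ext x; ring
          _ = (Fw b t * h y) * ∫⁻ x : ℝ, (D x * Fw b (t + A x y - B x y)) := by
              have : Measurable (fun x => A x y) := hA.comp measurable_prodMk_right
              have : Measurable (fun x => B x y) := hB.comp measurable_prodMk_right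
              rw [lintegral_const_mul _ (by fun_prop)]
          _ ≤ (Fw b t * h y) * C := by gcongr; exact H y t
          _ = _ := by ring
    _ = ∫⁻ t : ℝ, Fw b t * (C * ∫⁻ y, h y) := by
        congr 1; ext t
        rw [lintegral_const_mul _ hh, mul_assoc]
    _ = (∫⁻ t, Fw b t) * (C * ∫⁻ y, h y) := lintegral_mul_const _ (by fun_prop)
    _ ≤ J * (C * K) := by gcongr
    _ = _ := by ring

/-- modulation -/
def lam (w : E3) : ℝ := w.1 - w.2.1 ^ 3 - w.2.2 ^ 3

@[fun_prop]
lemma lam_meas : Measurable lam := by unfold lam; fun_prop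

def kP (s b : ℝ) (w v : E3) : ℝ :=
  Real.sqrt |w.2.1 ^ 2 - v.2.1 ^ 2| * jb w.2.2 ^ (-s) * (jb (lam w) ^ (-b) * jb (lam v) ^ (-b))

def kQ (s b : ℝ) (w v : E3) : ℝ :=
  Real.sqrt |(w.2.1 + v.2.1) ^ 2 - w.2.1 ^ 2| * jb w.2.2 ^ (-s) *
    (jb (lam w) ^ (-b) * jb (lam (w + v)) ^ (-b))

def kT (s b : ℝ) (w v : E3) : ℝ :=
  Real.sqrt (indicator (Icc (-1 : ℝ) 1) (fun _ => 1) (w.2.1 - v.2.1)) * jb w.2.2 ^ (-s) *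
    (jb (lam w) ^ (-b) * jb (lam v) ^ (-b))

lemma jb_sq (b x : ℝ) : ENNReal.ofReal (jb x ^ (-b)) ^ 2 = Fw b x := by
  rw [Fw, ← ENNReal.ofReal_pow (by have := jb_pos x; positivity), ← Real.rpow_natCast,
    ← Real.rpow_mul (jb_pos x).le]
  congr 2; push_cast; ring

lemma sq_form {d : ℝ} (hd : 0 ≤ d) (s b y l m : ℝ) :
    ENNReal.ofReal (Real.sqrt d * jb y ^ (-s) * (jb l ^ (-b) * jb m ^ (-b))) ^ 2 =
      ENNReal.ofReal d * Fw s y * (Fw b l * Fw b m) := by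
  have h1 := jb_pos y
  have h2 := jb_pos l
  have h3 := jb_pos m
  rw [ENNReal.ofReal_mul (by positivity), ENNReal.ofReal_mul (by positivity),
    ENNReal.ofReal_mul (by positivity), mul_pow, mul_pow, mul_pow, jb_sq, jb_sq, jb_sq,
    ← ENNReal.ofReal_pow (by positivity), Real.sq_sqrt hd]

@[fun_prop]
lemma kP_meas (s b : ℝ) : Measurable (Function.uncurry (kP s b)) := by
  unfold kP Function.uncurry; fun_prop

@[fun_prop]
lemma kQ_meas (s b : ℝ) : Measurable (Function.uncurry (kQ s b)) := by
  unfold kQ Function.uncurry; fun_prop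

@[fun_prop]
lemma kT_meas (s b : ℝ) : Measurable (Function.uncurry (kT s b)) := by
  have : Measurable (indicator (Icc (-1 : ℝ) 1) (fun _ => (1:ℝ))) :=
    measurable_const.indicator measurableSet_Icc
  unfold kT Function.uncurry; fun_prop

lemma kP_good {s b : ℝ} (hs : 1 / 2 < s) (hb : 1 / 2 < b) :
    Good (fun w v => ENNReal.ofReal (kP s b w v)) := by
  obtain ⟨J, hJ⟩ := Fw_int hb
  obtain ⟨K, hK⟩ := Fw_int hs
  refine good_of_sum (kP_meas s b).ennreal_ofReal (2 * J * J * K) fun p => ?_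
  have := triple_int b (fun x => ENNReal.ofReal |x ^ 2 - (p.2.1 - x) ^ 2|) (Fw s)
    (fun x y => x ^ 3 + y ^ 3) (fun x y => p.1 - (p.2.1 - x) ^ 3 - (p.2.2 - y) ^ 3) (2 * J) J K
    (by fun_prop) (by fun_prop) (by fun_prop) (by fun_prop) hJ hK
    (by
      intro y l
      have hq := quad_int (Fw b) (Fw_meas b) (3 * p.2.1) (-3 * p.2.1 ^ 2)
        (l + p.2.1 ^ 3 + y ^ 3 - p.1 + (p.2.2 - y) ^ 3)
      refine le_trans (lintegral_mono fun x => ?_) (hq.trans (by gcongr))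
      refine mul_le_mul' (ENNReal.ofReal_le_ofReal ?_) (le_of_eq ?_)
      · rw [show 2 * (3 * p.2.1) * x + -3 * p.2.1 ^ 2 = 3 * (x ^ 2 - (p.2.1 - x) ^ 2) by ring,
          abs_mul]
        norm_num
        linarith [abs_nonneg (x ^ 2 - (p.2.1 - x) ^ 2)]
      · congr 1; ring)
  refine le_trans (lintegral_mono fun w => ?_) (this.trans (le_of_eq (by push_cast; ring)))
  rw [kP, sq_form (abs_nonneg _)]
  refine le_of_eq ?_
  congr 2
  · congr 1; unfold lam; ring
  · rw [← Fw_neg]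
    congr 1; unfold lam; simp only [Prod.fst_sub, Prod.snd_sub]; ring

lemma kT_good {s b : ℝ} (hs : 1 / 2 < s) (hb : 1 / 2 < b) :
    Good (fun w v => ENNReal.ofReal (kT s b w v)) := by
  obtain ⟨J, hJ⟩ := Fw_int hb
  obtain ⟨K, hK⟩ := Fw_int hs
  have hi : ∀ a : ℝ, 0 ≤ indicator (Icc (-1 : ℝ) 1) (fun _ => (1:ℝ)) a := fun a =>
    indicator_nonneg (by simp) a
  have hm : Measurable (indicator (Icc (-1 : ℝ) 1) (fun _ => (1:ℝ))) :=
    measurable_const.indicator measurableSet_Icc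
  refine good_of_sum (kT_meas s b).ennreal_ofReal (1 * J * K) fun p => ?_
  have := triple_int b
    (fun x => ENNReal.ofReal (indicator (Icc (-1 : ℝ) 1) (fun _ => 1) (x - (p.2.1 - x)))) (Fw s)
    (fun x y => x ^ 3 + y ^ 3) (fun x y => p.1 - (p.2.1 - x) ^ 3 - (p.2.2 - y) ^ 3) 1 J K
    (by fun_prop) (by fun_prop) (by fun_prop) (by fun_prop) hJ hK
    (by
      intro y l
      calc _ ≤ ∫⁻ x, indicator (Icc ((p.2.1 - 1) / 2) ((p.2.1 + 1) / 2)) (fun _ => (1 : ℝ≥0∞)) x := by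
            refine lintegral_mono fun x => ?_
            refine (mul_le_mul' le_rfl (Fw_le_one hb _)).trans ?_
            rw [mul_one]
            by_cases hx : x - (p.2.1 - x) ∈ Icc (-1 : ℝ) 1
            · have hx' : x ∈ Icc ((p.2.1 - 1) / 2) ((p.2.1 + 1) / 2) := by
                constructor <;> linarith [hx.1, hx.2]
              simp [indicator_of_mem hx, indicator_of_mem hx']
            · simp [indicator_of_notMem hx]
        _ ≤ 1 := by
            rw [lintegral_indicator measurableSet_Icc]
            simp
            ring_nf; norm_num)
  refine le_trans (lintegral_mono fun w => ?_) (this.trans (le_of_eq (by push_cast; ring)))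
  rw [kT, sq_form (hi _)]
  refine le_of_eq ?_
  congr 2
  · congr 1; unfold lam; ring
  · rw [← Fw_neg]
    congr 1; unfold lam; simp only [Prod.fst_sub, Prod.snd_sub]; ring

lemma kQ_good {s b : ℝ} (hs : 1 / 2 < s) (hb : 1 / 2 < b) :
    Good (fun w v => ENNReal.ofReal (kQ s b w v)) := by
  obtain ⟨J, hJ⟩ := Fw_int hb
  obtain ⟨K, hK⟩ := Fw_int hs
  refine good_of_left (kQ_meas s b).ennreal_ofReal (2 * J * J * K) fun p => ?_
  have := triple_int b (fun x => ENNReal.ofReal |(x + p.2.1) ^ 2 - x ^ 2|) (Fw s)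
    (fun x y => x ^ 3 + y ^ 3) (fun x y => - p.1 + (x + p.2.1) ^ 3 + (y + p.2.2) ^ 3) (2 * J) J K
    (by fun_prop) (by fun_prop) (by fun_prop) (by fun_prop) hJ hK
    (by
      intro y l
      have hq := quad_int (Fw b) (Fw_meas b) (-3 * p.2.1) (-3 * p.2.1 ^ 2)
        (l - p.2.1 ^ 3 + y ^ 3 + p.1 - (y + p.2.2) ^ 3)
      refine le_trans (lintegral_mono fun x => ?_) (hq.trans (by gcongr))
      refine mul_le_mul' (ENNReal.ofReal_le_ofReal ?_) (le_of_eq ?_)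
      · rw [show 2 * (-3 * p.2.1) * x + -3 * p.2.1 ^ 2 = -3 * ((x + p.2.1) ^ 2 - x ^ 2) by ring,
          abs_mul]
        norm_num
        linarith [abs_nonneg ((x + p.2.1) ^ 2 - x ^ 2)]
      · congr 1; ring)
  refine le_trans (lintegral_mono fun w => ?_) (this.trans (le_of_eq (by push_cast; ring)))
  rw [kQ, sq_form (abs_nonneg _)]
  refine le_of_eq ?_
  congr 2
  · congr 1; unfold lam; ring
  · congr 1; unfold lam; simp only [Prod.fst_add, Prod.snd_add]; ring


lemma W0 {s a0 a1 a2 c : ℝ} (hs0 : 0 < s) (hs : s ≤ 1) (h0 : 0 < a0) (h1 : 0 < a1) (h2 : 0 < a2)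
    (hc : 1 ≤ c) (h : a0 ≤ c * a1) :
    a0 ^ s * a1 ^ (-s) * a2 ^ (-s) ≤ c * a2 ^ (-s) := by
  have e1 : a0 ^ s ≤ c * a1 ^ s := by
    calc a0 ^ s ≤ (c * a1) ^ s := Real.rpow_le_rpow h0.le h hs0.le
      _ = c ^ s * a1 ^ s := Real.mul_rpow (by linarith) h1.le
      _ ≤ c * a1 ^ s := by
        gcongr
        calc c ^ s ≤ c ^ (1 : ℝ) := Real.rpow_le_rpow_of_exponent_le hc hs
          _ = c := Real.rpow_one c
  have e2 : a1 ^ s * a1 ^ (-s) = 1 := by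
    rw [← Real.rpow_add h1]; simp
  have e3 : 0 < a1 ^ (-s) := by positivity
  calc a0 ^ s * a1 ^ (-s) * a2 ^ (-s) ≤ c * a1 ^ s * a1 ^ (-s) * a2 ^ (-s) := by gcongr
    _ = c * (a1 ^ s * a1 ^ (-s)) * a2 ^ (-s) := by ring
    _ = _ := by rw [e2]; ring

lemma jb2_sq (x y : ℝ) : jb2 x y ^ 2 = 1 + x ^ 2 + y ^ 2 := Real.sq_sqrt (by positivity)

lemma jb_sq' (x : ℝ) : jb x ^ 2 = 1 + x ^ 2 := Real.sq_sqrt (by positivity)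

lemma jb2_comm (x y : ℝ) : jb2 x y = jb2 y x := by unfold jb2; congr 1; ring

lemma jb_le_jb2 (x y : ℝ) : jb y ≤ jb2 x y :=
  Real.sqrt_le_sqrt (by nlinarith [sq_nonneg x])

lemma jb2_neg_le {s : ℝ} (hs : 0 < s) (x y : ℝ) : jb2 x y ^ (-s) ≤ jb y ^ (-s) :=
  Real.rpow_le_rpow_of_nonpos (jb_pos y) (jb_le_jb2 x y) (by linarith)

lemma jb2_neg_le' {s : ℝ} (hs : 0 < s) (x y : ℝ) : jb2 x y ^ (-s) ≤ jb x ^ (-s) := by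
  rw [jb2_comm]; exact jb2_neg_le hs y x

lemma abs_le_jb (x : ℝ) : |x| ≤ jb x := by
  rw [← Real.sqrt_sq_eq_abs]; exact Real.sqrt_le_sqrt (by linarith)

/-- the frequency weight -/
def Wt (s x1 y1 x2 y2 : ℝ) : ℝ :=
  jb2 (x1 + x2) (y1 + y2) ^ s * jb2 x1 y1 ^ (-s) * jb2 x2 y2 ^ (-s)

lemma Wt_nonneg (s x1 y1 x2 y2 : ℝ) : 0 ≤ Wt s x1 y1 x2 y2 := by
  have h1 := jb2_pos (x1 + x2) (y1 + y2)
  have h2 := jb2_pos x1 y1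
  have h3 := jb2_pos x2 y2
  unfold Wt; positivity

lemma Wt_swap (s x1 y1 x2 y2 : ℝ) : Wt s x1 y1 x2 y2 = Wt s y1 x1 y2 x2 := by
  simp only [Wt, jb2_comm]

lemma Wt_symm (s x1 y1 x2 y2 : ℝ) : Wt s x1 y1 x2 y2 = Wt s x2 y2 x1 y1 := by
  simp only [Wt, add_comm x1, add_comm y1]; ring

lemma Wt_le {s : ℝ} (hs0 : 0 < s) (hs : s ≤ 1) (x1 y1 x2 y2 : ℝ) :
    Wt s x1 y1 x2 y2 ≤ 2 * (jb y1 ^ (-s) + jb y2 ^ (-s)) := by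
  have key : ∀ x1 y1 x2 y2 : ℝ, jb2 x2 y2 ≤ jb2 x1 y1 →
      Wt s x1 y1 x2 y2 ≤ 2 * (jb y1 ^ (-s) + jb y2 ^ (-s)) := by
    intro x1 y1 x2 y2 h
    have h1 := jb2_pos x1 y1
    have h2 := jb2_pos x2 y2
    have h0 := jb2_pos (x1 + x2) (y1 + y2)
    have e : jb2 (x1 + x2) (y1 + y2) ≤ 2 * jb2 x1 y1 := by
      refine abs_le_of_sq_le_sq' ?_ (by positivity) |>.2
      have q0 := jb2_sq (x1 + x2) (y1 + y2)
      have q1 := jb2_sq x1 y1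
      have q2 := jb2_sq x2 y2
      nlinarith [sq_nonneg (x1 - x2), sq_nonneg (y1 - y2)]
    have := W0 hs0 hs h0 h1 h2 (by norm_num) e
    have e2 := jb2_neg_le hs0 x2 y2
    have e3 : 0 < jb y1 ^ (-s) := by have := jb_pos y1; positivity
    unfold Wt
    linarith
  rcases le_total (jb2 x2 y2) (jb2 x1 y1) with h | h
  · exact key _ _ _ _ h
  · rw [Wt_symm]; linarith [key _ _ _ _ h]

lemma cases5 (x1 y1 x2 y2 : ℝ) (hxy : |y1 + y2| ≤ |x1 + x2|) :
    (|(x1 + x2) + (y1 + y2)| ^ 2 ≤ 16 * |x1 ^ 2 - x2 ^ 2|) ∨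
    (|(x1 + x2) + (y1 + y2)| ^ 2 ≤ 16 * |y1 ^ 2 - y2 ^ 2|) ∨
    (|x1 - x2| ≤ |x1 + x2| / 4 ∧ |x1 + x2| < 1) ∨
    (|x1 - x2| ≤ |x1 + x2| / 4 ∧ 1 ≤ |x1 + x2| ∧ |(x1 + x2) + (y1 + y2)| ^ 3 / 40 ≤
      |(x1 + x2) * x1 * x2 + (y1 + y2) * y1 * y2|) ∨
    (1 ≤ |x1 + x2| ∧ 2 * |x1 + x2| < |y1 - y2| ∧
      |(x1 + x2) + (y1 + y2)| ^ 2 * |x1 + x2| ≤ 8 * |y1 - y2| * |y1 ^ 2 - y2 ^ 2|) := by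
  obtain ⟨x, hx⟩ : ∃ x, x = x1 + x2 := ⟨_, rfl⟩
  obtain ⟨y, hy⟩ : ∃ y, y = y1 + y2 := ⟨_, rfl⟩
  obtain ⟨u, hu⟩ : ∃ u, u = x1 - x2 := ⟨_, rfl⟩
  obtain ⟨v, hv⟩ : ∃ v, v = y1 - y2 := ⟨_, rfl⟩
  have exu : |x1 ^ 2 - x2 ^ 2| = |x| * |u| := by rw [← abs_mul, hx, hu]; congr 1; ring
  have eyv : |y1 ^ 2 - y2 ^ 2| = |y| * |v| := by rw [← abs_mul, hy, hv]; congr 1; ring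
  have eO : (x1 + x2) * x1 * x2 + (y1 + y2) * y1 * y2 =
      ((x + y) * (x ^ 2 - x * y + y ^ 2) - x * u ^ 2 - y * v ^ 2) / 4 := by
    rw [hx, hy, hu, hv]; ring
  rw [exu, eyv, eO]
  rw [← hx, ← hy] at hxy ⊢
  rw [← hu, ← hv]
  clear hx hy hu hv exu eyv eO x1 x2 y1 y2
  obtain ⟨X, hX⟩ : ∃ X, X = |x| := ⟨_, rfl⟩
  obtain ⟨A, hA⟩ : ∃ A, A = |x + y| := ⟨_, rfl⟩
  have hX0 : 0 ≤ X := hX ▸ abs_nonneg x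
  have hA0 : 0 ≤ A := hA ▸ abs_nonneg _
  have hAX : A ≤ 2 * X := by rw [hA, hX]; linarith [abs_add_le x y]
  have hU0 := abs_nonneg u
  have hV0 := abs_nonneg v
  have hY0 := abs_nonneg y
  rw [← hX] at hxy ⊢
  rw [← hA]
  by_contra hcon
  push Not at hcon
  obtain ⟨ha, hb, hc, hd, he⟩ := hcon
  have hXp : 0 < X := by
    by_contra h
    have : X = 0 := by linarith
    nlinarith
  have hAp : 0 < A := by
    by_contra h
    have h0 : A = 0 := by linarith
    rw [h0] at ha
    nlinarith [mul_nonneg hX0 hU0]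
  have hU : |u| ≤ A / 8 := by
    by_contra h
    push Not at h
    nlinarith
  have hU' : |u| ≤ X / 4 := by linarith
  have hX1 : 1 ≤ X := hc hU'
  have hO := hd hU' hX1
  have hE := he hX1
  have q1 : 3 / 4 * (A * X ^ 2) ≤ |(x + y) * (x ^ 2 - x * y + y ^ 2)| := by
    rw [abs_mul, ← hA]
    have : 3 / 4 * X ^ 2 ≤ |x ^ 2 - x * y + y ^ 2| := by
      rw [hX, sq_abs]
      refine le_trans ?_ (le_abs_self _)
      nlinarith [sq_nonneg (x - 2 * y)]
    nlinarith
  have q2 : |x * u ^ 2| ≤ A * X ^ 2 / 32 := by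
    rw [abs_mul, abs_pow, ← hX]
    have : |u| ^ 2 ≤ A / 8 * (X / 4) := by rw [sq]; gcongr
    nlinarith
  have tri : |(x + y) * (x ^ 2 - x * y + y ^ 2)| ≤
      |(x + y) * (x ^ 2 - x * y + y ^ 2) - x * u ^ 2 - y * v ^ 2| + |x * u ^ 2| + |y * v ^ 2| := by
    have := abs_add_three ((x + y) * (x ^ 2 - x * y + y ^ 2) - x * u ^ 2 - y * v ^ 2)
      (x * u ^ 2) (y * v ^ 2)
    refine le_trans (le_of_eq ?_) this
    congr 1; ring
  rw [abs_div] at hO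
  norm_num at hO
  have q3 : A ^ 3 ≤ 4 * (A * X ^ 2) := by
    have : A ^ 2 ≤ (2 * X) ^ 2 := by gcongr
    nlinarith
  have q4 : A * X ^ 2 / 4 < |y * v ^ 2| := by nlinarith
  have q5 : |y * v ^ 2| = |y| * |v| * |v| := by rw [abs_mul, abs_pow]; ring
  rw [q5] at q4
  by_cases hv : 2 * X < |v|
  · have := hE hv
    nlinarith [mul_nonneg hA0 hX0]
  · push Not at hv
    have : |y| * |v| * |v| ≤ (A ^ 2 / 16) * (2 * X) := by
      gcongr
      linarith
    nlinarith [mul_nonneg hA0 hX0]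


/-- the (dominating) kernel of the operator -/
def kM (s b : ℝ) (w v : E3) : ℝ :=
  |(w.2.1 + v.2.1) + (w.2.2 + v.2.2)| * Wt s w.2.1 w.2.2 v.2.1 v.2.2 *
    jb (lam (w + v)) ^ (-(1 / 3) : ℝ) * (jb (lam w) ^ (-b) * jb (lam v) ^ (-b))

def kG (s b : ℝ) (w v : E3) : ℝ := kP s b w v + kQ s b w v + kT s b w v

def kG1 (s b : ℝ) (w v : E3) : ℝ := kG s b w v + kG s b v w

def kG2 (s b : ℝ) (w v : E3) : ℝ := kG1 s b w v + kG1 s b (S3 w) (S3 v)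

lemma kP_nonneg (s b : ℝ) (w v : E3) : 0 ≤ kP s b w v := by
  have h1 := jb_pos w.2.2
  have h2 := jb_pos (lam w)
  have h3 := jb_pos (lam v)
  unfold kP; positivity

lemma kQ_nonneg (s b : ℝ) (w v : E3) : 0 ≤ kQ s b w v := by
  have h1 := jb_pos w.2.2
  have h2 := jb_pos (lam w)
  have h3 := jb_pos (lam (w + v))
  unfold kQ; positivity

lemma kT_nonneg (s b : ℝ) (w v : E3) : 0 ≤ kT s b w v := by
  have h1 := jb_pos w.2.2
  have h2 := jb_pos (lam w)
  have h3 := jb_pos (lam v)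
  unfold kT; positivity

lemma kG_nonneg (s b : ℝ) (w v : E3) : 0 ≤ kG s b w v :=
  add_nonneg (add_nonneg (kP_nonneg ..) (kQ_nonneg ..)) (kT_nonneg ..)

lemma cube_gain {A l : ℝ} (hA : 0 ≤ A) (h : A ^ 3 / 40 ≤ |l|) :
    A * jb l ^ (-(1 / 3) : ℝ) ≤ 4 := by
  have hp := jb_pos l
  have h1 := abs_le_jb l
  have h2 : A ≤ 4 * jb l ^ (1 / 3 : ℝ) := by
    have h3 : (jb l ^ (1 / 3 : ℝ)) ^ 3 = jb l := by
      rw [← Real.rpow_natCast, ← Real.rpow_mul hp.le]; norm_num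
    refine le_of_pow_le_pow_left₀ (n := 3) (by norm_num) (by positivity) ?_
    rw [mul_pow, h3]
    linarith
  calc A * jb l ^ (-(1 / 3) : ℝ) ≤ 4 * jb l ^ (1 / 3 : ℝ) * jb l ^ (-(1 / 3) : ℝ) := by gcongr
    _ = 4 * (jb l ^ (1 / 3 : ℝ) * jb l ^ (-(1 / 3) : ℝ)) := by ring
    _ = 4 := by rw [← Real.rpow_add hp]; norm_num

lemma exch {b p q : ℝ} (hb : 1 / 2 < b) (hp : 0 < p) (hpq : p ≤ q) :
    p ^ (-(1 / 3) : ℝ) * q ^ (-b) ≤ q ^ (-(1 / 3) : ℝ) * p ^ (-b) := by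
  have hq : 0 < q := hp.trans_le hpq
  have e1 : q ^ (-b) = q ^ (-(1 / 3) : ℝ) * q ^ (-(b - 1 / 3)) := by
    rw [← Real.rpow_add hq]; congr 1; ring
  have e2 : p ^ (-b) = p ^ (-(1 / 3) : ℝ) * p ^ (-(b - 1 / 3)) := by
    rw [← Real.rpow_add hp]; congr 1; ring
  have e3 : q ^ (-(b - 1 / 3)) ≤ p ^ (-(b - 1 / 3)) :=
    Real.rpow_le_rpow_of_nonpos hp hpq (by linarith)
  rw [e1, e2]
  calc _ = p ^ (-(1 / 3) : ℝ) * q ^ (-(1 / 3) : ℝ) * q ^ (-(b - 1 / 3)) := by ring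
    _ ≤ p ^ (-(1 / 3) : ℝ) * q ^ (-(1 / 3) : ℝ) * p ^ (-(b - 1 / 3)) := by gcongr
    _ = _ := by ring

lemma jb_mono {p q : ℝ} (h : |p| ≤ |q|) : jb p ≤ jb q :=
  Real.sqrt_le_sqrt (by have := sq_le_sq.2 h; linarith)

lemma jb_third_le_one (l : ℝ) : jb l ^ (-(1 / 3) : ℝ) ≤ 1 :=
  Real.rpow_le_one_of_one_le_of_nonpos (jb_one_le l) (by norm_num)

/-- The kernel in terms of `P`, when there is no need for the modulation gain. -/
lemma kM_le_P {s b c : ℝ} (hs0 : 0 < s) (hs : s ≤ 1) (w v : E3)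
    (hA : |(w.2.1 + v.2.1) + (w.2.2 + v.2.2)| * jb (lam (w + v)) ^ (-(1 / 3) : ℝ) ≤
      c * Real.sqrt |w.2.1 ^ 2 - v.2.1 ^ 2|) :
    kM s b w v ≤ 2 * c * (kP s b w v + kP s b v w) := by
  have hW := Wt_le hs0 hs w.2.1 w.2.2 v.2.1 v.2.2
  have hW0 := Wt_nonneg s w.2.1 w.2.2 v.2.1 v.2.2
  have h2 := jb_pos (lam w)
  have h3 := jb_pos (lam v)
  have h4 := jb_pos (lam (w + v))
  have h5 := jb_pos w.2.2
  have h6 := jb_pos v.2.2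
  unfold kM kP
  rw [abs_sub_comm (v.2.1 ^ 2)]
  set A := |(w.2.1 + v.2.1) + (w.2.2 + v.2.2)|
  calc _ = (A * jb (lam (w + v)) ^ (-(1 / 3) : ℝ)) * Wt s w.2.1 w.2.2 v.2.1 v.2.2 *
        (jb (lam w) ^ (-b) * jb (lam v) ^ (-b)) := by ring
    _ ≤ (c * Real.sqrt |w.2.1 ^ 2 - v.2.1 ^ 2|) * (2 * (jb w.2.2 ^ (-s) + jb v.2.2 ^ (-s))) *
        (jb (lam w) ^ (-b) * jb (lam v) ^ (-b)) := by
        gcongr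
        exact le_trans (by positivity) hA
    _ = _ := by ring

lemma kM_le_T {s b c : ℝ} (hs0 : 0 < s) (hs : s ≤ 1) (w v : E3)
    (hA : |(w.2.1 + v.2.1) + (w.2.2 + v.2.2)| * jb (lam (w + v)) ^ (-(1 / 3) : ℝ) ≤ c)
    (hu : |w.2.1 - v.2.1| ≤ 1) :
    kM s b w v ≤ 2 * c * (kT s b w v + kT s b v w) := by
  have hW := Wt_le hs0 hs w.2.1 w.2.2 v.2.1 v.2.2
  have hW0 := Wt_nonneg s w.2.1 w.2.2 v.2.1 v.2.2
  have h2 := jb_pos (lam w)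
  have h3 := jb_pos (lam v)
  have h4 := jb_pos (lam (w + v))
  have h5 := jb_pos w.2.2
  have h6 := jb_pos v.2.2
  unfold kM kT
  have hu' := abs_le.1 hu
  rw [indicator_of_mem (show w.2.1 - v.2.1 ∈ Icc (-1 : ℝ) 1 from ⟨hu'.1, hu'.2⟩),
    indicator_of_mem (show v.2.1 - w.2.1 ∈ Icc (-1 : ℝ) 1 from ⟨by linarith, by linarith⟩),
    Real.sqrt_one]
  set A := |(w.2.1 + v.2.1) + (w.2.2 + v.2.2)|
  calc _ = (A * jb (lam (w + v)) ^ (-(1 / 3) : ℝ)) * Wt s w.2.1 w.2.2 v.2.1 v.2.2 *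
        (jb (lam w) ^ (-b) * jb (lam v) ^ (-b)) := by ring
    _ ≤ c * (2 * (jb w.2.2 ^ (-s) + jb v.2.2 ^ (-s))) *
        (jb (lam w) ^ (-b) * jb (lam v) ^ (-b)) := by
        gcongr
        exact le_trans (by positivity) hA
    _ = _ := by ring

/-- The case where the modulation of the first factor is the largest. -/
lemma kM_le_Q {s b : ℝ} (hs0 : 0 < s) (hs : s ≤ 1) (hb : 1 / 2 < b) (w v : E3)
    (hxy : |w.2.2 + v.2.2| ≤ |w.2.1 + v.2.1|)
    (hu : |w.2.1 - v.2.1| ≤ |w.2.1 + v.2.1| / 4) (hX : 1 ≤ |w.2.1 + v.2.1|)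
    (hl : |lam (w + v)| ≤ |lam w|)
    (hA : |(w.2.1 + v.2.1) + (w.2.2 + v.2.2)| ^ 3 / 40 ≤ |lam w|) :
    kM s b w v ≤ 48 * kQ s b v w := by
  have hg := cube_gain (abs_nonneg _) hA
  have hex := exch hb (jb_pos (lam (w + v))) (jb_mono hl)
  have h2 := jb_pos (lam w)
  have h3 := jb_pos (lam v)
  have h4 := jb_pos (lam (w + v))
  have h6 := jb_pos v.2.2
  have hW0 := Wt_nonneg s w.2.1 w.2.2 v.2.1 v.2.2
  obtain ⟨x, hx⟩ : ∃ x, x = w.2.1 + v.2.1 := ⟨_, rfl⟩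
  obtain ⟨u, hu'⟩ : ∃ u, u = w.2.1 - v.2.1 := ⟨_, rfl⟩
  have hx1 : w.2.1 = (x + u) / 2 := by linarith
  have hx2 : v.2.1 = (x - u) / 2 := by linarith
  have hu2 : u ^ 2 ≤ x ^ 2 / 16 := by
    rw [← hx, ← hu'] at hu
    have := sq_le_sq.2 (show |u| ≤ |x / 4| by rw [abs_div]; norm_num; linarith)
    linarith
  have hX2 : 1 ≤ x ^ 2 := by
    rw [← hx] at hX; rw [← sq_abs]; nlinarith
  have hy2 : (w.2.2 + v.2.2) ^ 2 ≤ x ^ 2 := by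
    rw [hx]; exact sq_le_sq.2 hxy
  have hux : |u * x| ≤ x ^ 2 / 4 := by
    rw [← hx, ← hu'] at hu
    rw [abs_mul, ← sq_abs x]; nlinarith [abs_nonneg x]
  have hux' := abs_le.1 hux
  have hW : Wt s w.2.1 w.2.2 v.2.1 v.2.2 ≤ 6 * jb v.2.2 ^ (-s) := by
    have e : jb2 (w.2.1 + v.2.1) (w.2.2 + v.2.2) ≤ 6 * jb2 w.2.1 w.2.2 := by
      have h1 := jb2_pos w.2.1 w.2.2
      refine abs_le_of_sq_le_sq' ?_ (by positivity) |>.2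
      have q0 := jb2_sq (w.2.1 + v.2.1) (w.2.2 + v.2.2)
      have q1 := jb2_sq w.2.1 w.2.2
      rw [← hx] at q0 ⊢
      rw [mul_pow, q0, q1, hx1]
      nlinarith [sq_nonneg w.2.2]
    have := W0 hs0 hs (jb2_pos _ _) (jb2_pos w.2.1 w.2.2) (jb2_pos v.2.1 v.2.2) (by norm_num) e
    have e2 := jb2_neg_le hs0 v.2.1 v.2.2
    unfold Wt
    linarith
  have hS : 1 ≤ 2 * Real.sqrt |(v.2.1 + w.2.1) ^ 2 - v.2.1 ^ 2| := by
    have : (1 / 2) ≤ Real.sqrt |(v.2.1 + w.2.1) ^ 2 - v.2.1 ^ 2| := by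
      refine Real.le_sqrt_of_sq_le (le_trans ?_ (le_abs_self _))
      rw [add_comm v.2.1, ← hx, hx2]
      nlinarith
    linarith
  unfold kM kQ
  rw [add_comm v w]
  set A := |(w.2.1 + v.2.1) + (w.2.2 + v.2.2)|
  have hA0 : 0 ≤ A := abs_nonneg _
  calc _ = A * Wt s w.2.1 w.2.2 v.2.1 v.2.2 * (jb (lam (w + v)) ^ (-(1 / 3) : ℝ) * jb (lam w) ^ (-b))
         * jb (lam v) ^ (-b) := by ring
    _ ≤ A * (6 * jb v.2.2 ^ (-s)) * (jb (lam w) ^ (-(1 / 3) : ℝ) * jb (lam (w + v)) ^ (-b))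
         * jb (lam v) ^ (-b) := by gcongr
    _ = (A * jb (lam w) ^ (-(1 / 3) : ℝ)) * (6 * jb v.2.2 ^ (-s) * (jb (lam v) ^ (-b) *
          jb (lam (w + v)) ^ (-b))) * 1 := by ring
    _ ≤ 4 * (6 * jb v.2.2 ^ (-s) * (jb (lam v) ^ (-b) *
          jb (lam (w + v)) ^ (-b))) * (2 * Real.sqrt |(v.2.1 + w.2.1) ^ 2 - v.2.1 ^ 2|) := by gcongr
    _ = _ := by ring

/-- The case of a large transversal frequency difference. -/
lemma kM_le_E {s b : ℝ} (hs0 : 1 / 2 < s) (hs : s ≤ 1) (w v : E3)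
    (hxy : |w.2.2 + v.2.2| ≤ |w.2.1 + v.2.1|)
    (hX : 1 ≤ |w.2.1 + v.2.1|) (hv : 2 * |w.2.1 + v.2.1| < |w.2.2 - v.2.2|)
    (hA : |(w.2.1 + v.2.1) + (w.2.2 + v.2.2)| ^ 2 * |w.2.1 + v.2.1| ≤
      8 * |w.2.2 - v.2.2| * |w.2.2 ^ 2 - v.2.2 ^ 2|) :
    kM s b w v ≤ 24 * kP s b (S3 v) (S3 w) := by
  have h2 := jb_pos (lam w)
  have h3 := jb_pos (lam v)
  have h4 := jb_pos (lam (w + v))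
  have h6 := jb_pos v.2.1
  have hW0 := Wt_nonneg s w.2.1 w.2.2 v.2.1 v.2.2
  have l1 : lam (S3 v) = lam v := by simp only [lam, S3]; ring
  have l2 : lam (S3 w) = lam w := by simp only [lam, S3]; ring
  unfold kM kP
  rw [l1, l2]
  simp only [S3]
  rw [abs_sub_comm (v.2.2 ^ 2)]
  obtain ⟨A, hAe⟩ : ∃ A, A = |(w.2.1 + v.2.1) + (w.2.2 + v.2.2)| := ⟨_, rfl⟩
  obtain ⟨X, hXe⟩ : ∃ X, X = |w.2.1 + v.2.1| := ⟨_, rfl⟩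
  obtain ⟨V, hVe⟩ : ∃ V, V = |w.2.2 - v.2.2| := ⟨_, rfl⟩
  obtain ⟨Y, hYe⟩ : ∃ Y, Y = |w.2.2 ^ 2 - v.2.2 ^ 2| := ⟨_, rfl⟩
  rw [← hAe, ← hXe, ← hVe, ← hYe] at hA
  rw [← hAe, ← hYe]
  rw [← hXe] at hxy hX
  rw [← hXe, ← hVe] at hv
  have hA0 : 0 ≤ A := hAe ▸ abs_nonneg _
  have hY0 : 0 ≤ Y := hYe ▸ abs_nonneg _
  have hXp : 0 < X := by linarith
  have hVp : 0 < V := by linarith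
  obtain ⟨r, hr⟩ : ∃ r, r = X / V := ⟨_, rfl⟩
  have hr0 : 0 < r := by rw [hr]; positivity
  have hr1 : r ≤ 1 := by rw [hr, div_le_one hVp]; linarith
  have hrV : r * V = X := by rw [hr]; field_simp
  -- bound on A
  have a1 : A * Real.sqrt r ≤ 3 * Real.sqrt Y := by
    refine abs_le_of_sq_le_sq' ?_ (by positivity) |>.2
    rw [mul_pow, mul_pow, Real.sq_sqrt hr0.le, Real.sq_sqrt hY0]
    have : A ^ 2 * r * V ≤ 8 * Y * V := by
      rw [mul_assoc, hrV]; linarith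
    have := le_of_mul_le_mul_right this hVp
    linarith
  -- bound on the weight
  have b0 : jb2 (w.2.1 + v.2.1) (w.2.2 + v.2.2) ≤ 8 * r * jb2 w.2.1 w.2.2 := by
    have c1 : jb2 (w.2.1 + v.2.1) (w.2.2 + v.2.2) ≤ 2 * X := by
      refine abs_le_of_sq_le_sq' ?_ (by positivity) |>.2
      have d1 : (w.2.2 + v.2.2) ^ 2 ≤ X ^ 2 := by
        rw [← sq_abs (w.2.2 + v.2.2)]; gcongr
      have d2 : (w.2.1 + v.2.1) ^ 2 = X ^ 2 := by rw [hXe, sq_abs]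
      rw [jb2_sq, d2]
      nlinarith
    have c2 : V ≤ 4 * jb2 w.2.1 w.2.2 := by
      have d1 : |w.2.2| ≤ jb2 w.2.1 w.2.2 := (abs_le_jb _).trans (jb_le_jb2 _ _)
      have d2 : V ≤ 2 * |w.2.2| + X := by
        have := abs_sub (2 * w.2.2) (w.2.2 + v.2.2)
        rw [abs_mul, abs_two] at this
        rw [hVe, show w.2.2 - v.2.2 = 2 * w.2.2 - (w.2.2 + v.2.2) by ring]
        linarith
      linarith
    calc _ ≤ 2 * X := c1
      _ = 2 * r * V := by rw [← hrV]; ring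
      _ ≤ 2 * r * (4 * jb2 w.2.1 w.2.2) := by gcongr
      _ = _ := by ring
  have b1 : Wt s w.2.1 w.2.2 v.2.1 v.2.2 ≤ 8 * Real.sqrt r * jb v.2.1 ^ (-s) := by
    have p1 := jb2_pos w.2.1 w.2.2
    have p2 := jb2_pos v.2.1 v.2.2
    have p0 := jb2_pos (w.2.1 + v.2.1) (w.2.2 + v.2.2)
    have e1 : jb2 (w.2.1 + v.2.1) (w.2.2 + v.2.2) ^ s ≤ 8 * Real.sqrt r * jb2 w.2.1 w.2.2 ^ s := by
      calc _ ≤ (8 * r * jb2 w.2.1 w.2.2) ^ s := Real.rpow_le_rpow p0.le b0 (by linarith)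
        _ = 8 ^ s * r ^ s * jb2 w.2.1 w.2.2 ^ s := by
          rw [Real.mul_rpow (by positivity) p1.le, Real.mul_rpow (by norm_num) hr0.le]
        _ ≤ 8 * Real.sqrt r * jb2 w.2.1 w.2.2 ^ s := by
          gcongr
          · calc (8 : ℝ) ^ s ≤ 8 ^ (1 : ℝ) := Real.rpow_le_rpow_of_exponent_le (by norm_num) hs
              _ = 8 := Real.rpow_one _
          · rw [Real.sqrt_eq_rpow]
            exact Real.rpow_le_rpow_of_exponent_ge hr0 hr1 hs0.le
    have e2 : jb2 w.2.1 w.2.2 ^ s * jb2 w.2.1 w.2.2 ^ (-s) = 1 := by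
      rw [← Real.rpow_add p1]; simp
    have e3 := jb2_neg_le' (by linarith : 0 < s) v.2.1 v.2.2
    unfold Wt
    calc _ ≤ 8 * Real.sqrt r * jb2 w.2.1 w.2.2 ^ s * jb2 w.2.1 w.2.2 ^ (-s) *
          jb v.2.1 ^ (-s) := by gcongr
      _ = 8 * Real.sqrt r * (jb2 w.2.1 w.2.2 ^ s * jb2 w.2.1 w.2.2 ^ (-s)) * jb v.2.1 ^ (-s) := by
          ring
      _ = _ := by rw [e2, mul_one]
  have t1 := jb_third_le_one (lam (w + v))
  calc _ ≤ A * (8 * Real.sqrt r * jb v.2.1 ^ (-s)) * 1 *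
        (jb (lam w) ^ (-b) * jb (lam v) ^ (-b)) := by gcongr
    _ = (A * Real.sqrt r) * (8 * jb v.2.1 ^ (-s) * (jb (lam w) ^ (-b) * jb (lam v) ^ (-b))) := by
        ring
    _ ≤ (3 * Real.sqrt Y) * (8 * jb v.2.1 ^ (-s) * (jb (lam w) ^ (-b) * jb (lam v) ^ (-b))) := by
        gcongr
    _ = _ := by ring

lemma S3_add (w v : E3) : S3 w + S3 v = S3 (w + v) := rfl

lemma lam_S3 (w : E3) : lam (S3 w) = lam w := by simp only [lam, S3]; ring

lemma kM_S3 (s b : ℝ) (w v : E3) : kM s b (S3 w) (S3 v) = kM s b w v := by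
  unfold kM
  rw [S3_add, lam_S3, lam_S3, lam_S3, Wt_swap s w.2.1]
  simp only [S3]
  rw [add_comm (w.2.2 + v.2.2)]

lemma kM_symm (s b : ℝ) (w v : E3) : kM s b w v = kM s b v w := by
  unfold kM
  rw [add_comm w v, Wt_symm, add_comm w.2.1, add_comm w.2.2]
  ring

lemma kM_le_half {s b : ℝ} (hs0 : 1 / 2 < s) (hs : s ≤ 1) (hb : 1 / 2 < b) (w v : E3)
    (hxy : |w.2.2 + v.2.2| ≤ |w.2.1 + v.2.1|) : kM s b w v ≤ 48 * kG2 s b w v := by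
  have hs0' : 0 < s := by linarith
  have n1 := kP_nonneg s b w v
  have n2 := kP_nonneg s b v w
  have n3 := kP_nonneg s b (S3 w) (S3 v)
  have n4 := kP_nonneg s b (S3 v) (S3 w)
  have n5 := kQ_nonneg s b w v
  have n6 := kQ_nonneg s b v w
  have n7 := kQ_nonneg s b (S3 w) (S3 v)
  have n8 := kQ_nonneg s b (S3 v) (S3 w)
  have n9 := kT_nonneg s b w v
  have n10 := kT_nonneg s b v w
  have n11 := kT_nonneg s b (S3 w) (S3 v)
  have n12 := kT_nonneg s b (S3 v) (S3 w)
  have t1 := jb_third_le_one (lam (w + v))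
  have hA0 := abs_nonneg ((w.2.1 + v.2.1) + (w.2.2 + v.2.2))
  have hA1 : |(w.2.1 + v.2.1) + (w.2.2 + v.2.2)| * jb (lam (w + v)) ^ (-(1 / 3) : ℝ) ≤
      |(w.2.1 + v.2.1) + (w.2.2 + v.2.2)| := mul_le_of_le_one_right hA0 t1
  have hAX : |(w.2.1 + v.2.1) + (w.2.2 + v.2.2)| ≤ 2 * |w.2.1 + v.2.1| := by
    linarith [abs_add_le (w.2.1 + v.2.1) (w.2.2 + v.2.2)]
  have sq4 : ∀ A Y : ℝ, A ^ 2 ≤ 16 * |Y| → A ≤ 4 * Real.sqrt |Y| := by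
    intro A Y h
    refine abs_le_of_sq_le_sq' ?_ (by positivity) |>.2
    rw [mul_pow, Real.sq_sqrt (abs_nonneg _)]; linarith
  unfold kG2 kG1 kG
  rcases cases5 w.2.1 w.2.2 v.2.1 v.2.2 hxy with h | h | ⟨h, h'⟩ | ⟨h, h', h''⟩ | ⟨h, h', h''⟩
  · have := kM_le_P (b := b) hs0' hs w v (hA1.trans (sq4 _ _ h))
    linarith
  · rw [← kM_S3]
    have := kM_le_P (b := b) (c := 4) hs0' hs (S3 w) (S3 v) (by
      rw [S3_add, lam_S3]
      simp only [S3]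
      rw [add_comm (w.2.2 + v.2.2)]
      exact hA1.trans (sq4 _ _ h))
    linarith
  · have := kM_le_T (b := b) (c := 2) hs0' hs w v (by linarith) (by linarith)
    linarith
  · have hres : lam w + lam v - lam (w + v) = 3 * ((w.2.1 + v.2.1) * w.2.1 * v.2.1 +
        (w.2.2 + v.2.2) * w.2.2 * v.2.2) := by
      simp only [lam, Prod.fst_add, Prod.snd_add]; ring
    have htri : 3 * |(w.2.1 + v.2.1) * w.2.1 * v.2.1 + (w.2.2 + v.2.2) * w.2.2 * v.2.2| ≤
        |lam w| + |lam v| + |lam (w + v)| := by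
      have e : 3 * |(w.2.1 + v.2.1) * w.2.1 * v.2.1 + (w.2.2 + v.2.2) * w.2.2 * v.2.2| =
        |lam w + lam v - lam (w + v)| := by rw [hres, abs_mul]; norm_num
      rw [e]
      linarith [abs_sub (lam w + lam v) (lam (w + v)), abs_add_le (lam w) (lam v)]
    by_cases hc0 : |lam w| ≤ |lam (w + v)| ∧ |lam v| ≤ |lam (w + v)|
    · have hg := cube_gain (l := lam (w + v)) hA0 (by linarith [hc0.1, hc0.2])
      by_cases hu : |w.2.1 - v.2.1| ≤ 1
      · have := kM_le_T (b := b) hs0' hs w v hg hu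
        linarith
      · push Not at hu
        have h1 : 1 ≤ Real.sqrt |w.2.1 ^ 2 - v.2.1 ^ 2| := by
          rw [Real.one_le_sqrt, show w.2.1 ^ 2 - v.2.1 ^ 2 = (w.2.1 + v.2.1) * (w.2.1 - v.2.1) by ring,
            abs_mul]
          nlinarith
        have := kM_le_P (b := b) (c := 4) hs0' hs w v (by linarith)
        linarith
    · by_cases hc1 : |lam v| ≤ |lam w|
      · have hl : |lam (w + v)| ≤ |lam w| := by
          by_contra hh
          push Not at hh
          exact hc0 ⟨hh.le, by linarith⟩
        have := kM_le_Q hs0' hs hb w v hxy h h' hl (by linarith)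
        linarith
      · push Not at hc1
        have hl : |lam (w + v)| ≤ |lam v| := by
          by_contra hh
          push Not at hh
          exact hc0 ⟨by linarith, hh.le⟩
        have := kM_le_Q hs0' hs hb v w (by rwa [add_comm v.2.2, add_comm v.2.1])
          (by rwa [abs_sub_comm, add_comm v.2.1]) (by rwa [add_comm v.2.1])
          (by rwa [add_comm v w]) (by rw [add_comm v.2.1, add_comm v.2.2]; linarith)
        rw [kM_symm]
        linarith
  · have := kM_le_E (b := b) hs0 hs w v hxy h h' h''
    linarith

lemma kM_le {s b : ℝ} (hs0 : 1 / 2 < s) (hs : s ≤ 1) (hb : 1 / 2 < b) (w v : E3) :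
    kM s b w v ≤ 48 * kG2 s b w v := by
  rcases le_total |w.2.2 + v.2.2| |w.2.1 + v.2.1| with h | h
  · exact kM_le_half hs0 hs hb w v h
  · rw [← kM_S3]
    have := kM_le_half hs0 hs hb (S3 w) (S3 v) h
    refine this.trans (le_of_eq ?_)
    unfold kG2
    rw [S3_S3, S3_S3, add_comm (kG1 s b (S3 w) (S3 v))]

lemma kM_good {s b : ℝ} (hs0 : 1 / 2 < s) (hs : s ≤ 1) (hb : 1 / 2 < b) :
    Good (fun w v => ENNReal.ofReal (kM s b w v)) := by
  have mP : Measurable (Function.uncurry (fun w v => ENNReal.ofReal (kP s b w v))) :=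
    (kP_meas s b).ennreal_ofReal
  have mQ : Measurable (Function.uncurry (fun w v => ENNReal.ofReal (kQ s b w v))) :=
    (kQ_meas s b).ennreal_ofReal
  have mT : Measurable (Function.uncurry (fun w v => ENNReal.ofReal (kT s b w v))) :=
    (kT_meas s b).ennreal_ofReal
  have g1 := ((kP_good hs0 hb).add (kQ_good hs0 hb) mP).add (kT_good hs0 hb) (mP.add mQ)
  have m1 := (mP.add mQ).add mT
  have g2 := g1.add (g1.swap m1) m1
  have m2 := m1.add (m1.comp measurable_swap)
  have g3 := g2.add g2.refl m2
  refine g3.mono 48 fun w v => ?_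
  refine (ENNReal.ofReal_le_ofReal (kM_le hs0 hs hb w v)).trans (le_of_eq ?_)
  have a1 : ∀ w v : E3, ENNReal.ofReal (kG s b w v) = ENNReal.ofReal (kP s b w v) +
      ENNReal.ofReal (kQ s b w v) + ENNReal.ofReal (kT s b w v) := by
    intro w v
    rw [kG, ENNReal.ofReal_add (add_nonneg (kP_nonneg ..) (kQ_nonneg ..)) (kT_nonneg ..),
      ENNReal.ofReal_add (kP_nonneg ..) (kQ_nonneg ..)]
  have a2 : ∀ w v : E3, 0 ≤ kG1 s b w v := fun w v => add_nonneg (kG_nonneg ..) (kG_nonneg ..)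
  rw [ENNReal.ofReal_mul (by norm_num), kG2, ENNReal.ofReal_add (a2 _ _) (a2 _ _), kG1, kG1,
    ENNReal.ofReal_add (kG_nonneg ..) (kG_nonneg ..),
    ENNReal.ofReal_add (kG_nonneg ..) (kG_nonneg ..), a1, a1, a1, a1]
  congr 1
  norm_num



lemma kM_meas (s b : ℝ) : Measurable (fun p : E3 × E3 => ENNReal.ofReal (kM s b p.1 p.2)) := by
  have h1 := jb_meas
  have h2 := lam_meas
  unfold kM Wt jb2
  fun_prop

lemma Mop_real (s b b' : ℝ) (hb' : b' ≤ -(1 / 3)) (w v : E3) :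
    (|(w + v).2.1 + (w + v).2.2| * jb2 (w + v).2.1 (w + v).2.2 ^ s * jb (lam (w + v)) ^ b') *
      (jb (lam w) ^ b * jb2 w.2.1 w.2.2 ^ s * jb (lam v) ^ b * jb2 v.2.1 v.2.2 ^ s)⁻¹
      ≤ kM s b w v := by
  have e : jb (lam (w + v)) ^ b' ≤ jb (lam (w + v)) ^ (-(1 / 3) : ℝ) :=
    Real.rpow_le_rpow_of_exponent_le (jb_one_le _) hb'
  have p1 := jb_pos (lam w)
  have p2 := jb_pos (lam v)
  have p3 := jb2_pos w.2.1 w.2.2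
  have p4 := jb2_pos v.2.1 v.2.2
  have p5 := jb2_pos (w + v).2.1 (w + v).2.2
  have hk : kM s b w v =
      (|(w + v).2.1 + (w + v).2.2| * jb2 (w + v).2.1 (w + v).2.2 ^ s *
        jb (lam (w + v)) ^ (-(1 / 3) : ℝ)) *
      (jb (lam w) ^ b * jb2 w.2.1 w.2.2 ^ s * jb (lam v) ^ b * jb2 v.2.1 v.2.2 ^ s)⁻¹ := by
    unfold kM Wt
    rw [Real.rpow_neg p1.le, Real.rpow_neg p2.le, Real.rpow_neg p3.le, Real.rpow_neg p4.le]
    simp only [mul_inv, Prod.fst_add, Prod.snd_add]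
    ring
  rw [hk]
  gcongr

lemma Mop_point (s b b' : ℝ) (hb' : b' ≤ -(1 / 3)) (p w : E3) (A B G : ℝ≥0∞) :
    ENNReal.ofReal
      (|p.2.1 + p.2.2| * jb2 p.2.1 p.2.2 ^ s * jb (p.1 - p.2.1 ^ 3 - p.2.2 ^ 3) ^ b') *
    (A * B / ENNReal.ofReal
          (jb (w.1 - w.2.1 ^ 3 - w.2.2 ^ 3) ^ b * jb2 w.2.1 w.2.2 ^ s *
            jb ((p.1 - w.1) - (p.2.1 - w.2.1) ^ 3 - (p.2.2 - w.2.2) ^ 3) ^ b *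
            jb2 (p.2.1 - w.2.1) (p.2.2 - w.2.2) ^ s)) * G
      ≤ ENNReal.ofReal (kM s b w (p - w)) * (A * B * G) := by
  have h := Mop_real s b b' hb' w (p - w)
  rw [add_sub_cancel] at h
  have p1 := jb_pos (lam w)
  have p2 := jb_pos (lam (p - w))
  have p3 := jb2_pos w.2.1 w.2.2
  have p4 := jb2_pos (p - w).2.1 (p - w).2.2
  have p5 := jb2_pos p.2.1 p.2.2
  have p6 := jb_pos (lam p)
  change ENNReal.ofReal
      (|p.2.1 + p.2.2| * jb2 p.2.1 p.2.2 ^ s * jb (lam p) ^ b') *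
    (A * B / ENNReal.ofReal (jb (lam w) ^ b * jb2 w.2.1 w.2.2 ^ s *
            jb (lam (p - w)) ^ b * jb2 (p - w).2.1 (p - w).2.2 ^ s)) * G ≤ _
  rw [div_eq_mul_inv, ← ENNReal.ofReal_inv_of_pos (by positivity)]
  calc _ = (ENNReal.ofReal (|p.2.1 + p.2.2| * jb2 p.2.1 p.2.2 ^ s * jb (lam p) ^ b') *
        ENNReal.ofReal (jb (lam w) ^ b * jb2 w.2.1 w.2.2 ^ s *
            jb (lam (p - w)) ^ b * jb2 (p - w).2.1 (p - w).2.2 ^ s)⁻¹) * (A * B * G) := by ring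
    _ ≤ _ := by
        rw [← ENNReal.ofReal_mul (by positivity)]
        gcongr

lemma L2NR_eq (f : E3 → ℝ) (hf : ∀ w, 0 ≤ f w) :
    n2 (fun w => ENNReal.ofReal (f w)) = L2NR f := by
  unfold n2 nrm2 L2NR
  congr 2
  ext w
  congr 1
  exact (Real.enorm_of_nonneg (hf w)).symm

lemma conv_swap {k : E3 → E3 → ℝ≥0∞} (hk : Measurable (fun p : E3 × E3 => k p.1 p.2))
    (f₁ f₂ g : E3 → ℝ≥0∞) (h1 : Measurable f₁) (h2 : Measurable f₂) (h3 : Measurable g) :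
    ∫⁻ p : E3, ∫⁻ w : E3, k w (p - w) * (f₁ w * f₂ (p - w) * g p) =
      ∫⁻ w : E3, ∫⁻ v : E3, k w v * (f₁ w * f₂ v * g (w + v)) := by
  have hk'' : Measurable (fun p : E3 × E3 => k p.1 (p.2 - p.1)) :=
    hk.comp (by fun_prop : Measurable (fun p : E3 × E3 => (p.1, p.2 - p.1)))
  have hu : Measurable
      (fun p : E3 × E3 => k p.1 (p.2 - p.1) * (f₁ p.1 * f₂ (p.2 - p.1) * g p.2)) := by
    fun_prop
  rw [← lintegral_lintegral_swap hu.aemeasurable]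
  congr 1; ext w
  rw [← lintegral_sub_right_eq_self (fun v => k w v * (f₁ w * f₂ v * g (w + v))) w]
  simp


/-- the weighted `L²` convolution estimate
`‖M(f₁,f₂)‖_{L²} ≲ ‖f₁‖_{L²} ‖f₂‖_{L²}` for nonnegative `f₁, f₂ ∈ L²(ℝ³)`,
`1/2 < s ≤ 3/4`, `b > 1/2`, `b' ≤ -1/3`. -/
theorem weighted_convolution_estimate (s b b' : ℝ) (hs1 : 1 / 2 < s) (hs2 : s ≤ 3 / 4)
    (hb : 1 / 2 < b) (hb' : b' ≤ -(1 / 3)) :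
    ∃ C : ℝ≥0, 0 < C ∧ ∀ f₁ f₂ : ℝ × ℝ × ℝ → ℝ,
      Measurable f₁ → Measurable f₂ → (∀ w, 0 ≤ f₁ w) → (∀ w, 0 ≤ f₂ w) →
      L2NR f₁ ≠ ⊤ → L2NR f₂ ≠ ⊤ →
      (∫⁻ p : ℝ × ℝ × ℝ, (Mop s b b' f₁ f₂ p) ^ 2) ^ (1 / 2 : ℝ) ≤
        (C : ℝ≥0∞) * L2NR f₁ * L2NR f₂ := by
  obtain ⟨C, hC⟩ := kM_good hs1 (by linarith) hb
  refine ⟨C + 1, by positivity, fun f₁ f₂ m1 m2 n1 n2' _ _ => ?_⟩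
  change nrm2 volume (Mop s b b' f₁ f₂) ≤ _
  refine (dual volume _ ((C : ℝ≥0∞) * L2NR f₁ * L2NR f₂) fun g hg => ?_).trans ?_
  · have hF1 : Measurable (fun w => ENNReal.ofReal (f₁ w)) := m1.ennreal_ofReal
    have hF2 : Measurable (fun w => ENNReal.ofReal (f₂ w)) := m2.ennreal_ofReal
    have key := hC _ _ g hF1 hF2 hg
    rw [L2NR_eq f₁ n1, L2NR_eq f₂ n2'] at key
    calc _ ≤ ∫⁻ p : E3, ∫⁻ w : E3, ENNReal.ofReal (kM s b w (p - w)) *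
          (ENNReal.ofReal (f₁ w) * ENNReal.ofReal (f₂ (p - w)) * g p) := by
          refine lintegral_mono fun p => ?_
          unfold Mop
          refine (mul_le_mul_left (lintegral_const_mul_le _ _) _).trans ?_
          refine (lintegral_mul_const_le _ _).trans ?_
          exact lintegral_mono fun w => Mop_point s b b' hb' p w _ _ _
      _ = _ := conv_swap (k := fun w v => ENNReal.ofReal (kM s b w v)) (kM_meas s b)
          (fun w => ENNReal.ofReal (f₁ w)) (fun w => ENNReal.ofReal (f₂ w)) g hF1 hF2 hg
      _ ≤ _ := key
  · gcongr
    exact_mod_cast le_self_add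

end
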